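/- Let U : H^{P_O} ⊗ H^{A_O} ⊗ H^{B_O} ⊗ H^{C_O} → H^{F_I} ⊗ H^{A_I} ⊗ H^{B_I} ⊗ H^{C_I} be a unitary extension of a tripartite process. Then there exist finite-dimensional isomorphic spaces H^Z, H^{Z̄} and unitaries U₁ : H^{P_O} ⊗ H^{A_O} ⊗ H^{B_O} → H^{C_I} ⊗ H^Z and U₂ : H^{C_O} ⊗ H^{Z̄} → H^{A_I} ⊗ H^{B_I} ⊗ H^{F_I} such that |U⟩⟩ = |U₁⟩⟩ * |𝟙⟩⟩^{ZZ̄} * |U₂⟩⟩; that is, U maps a subsystem of P_O A_O B_O isomorphically onto C_I and maps C_O isomorphically onto a subsystem of A_I B_I F_I. -/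

import Mathlib

open Matrix

/-- Every orthogonal projection matrix factors through an isometry onto its range. -/
lemma exists_isometry_of_isHermitian_of_idempotent {X : Type*} [Fintype X] [DecidableEq X]
    (P : Matrix X X ℂ) (hP : P.IsHermitian) (hPP : P * P = P) :
    ∃ (r : ℕ) (J : Matrix X (Fin r) ℂ), Jᴴ * J = 1 ∧ J * Jᴴ = P := by
  classical
  set W : Matrix X X ℂ := (hP.eigenvectorUnitary : Matrix X X ℂ) with hW
  have hWW : Wᴴ * W = 1 := Unitary.coe_star_mul_self hP.eigenvectorUnitary
  have hWW' : W * Wᴴ = 1 := Unitary.coe_mul_star_self hP.eigenvectorUnitary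
  set D : Matrix X X ℂ := diagonal (RCLike.ofReal ∘ hP.eigenvalues) with hD
  have hspec : P = W * D * Wᴴ := by
    have h := hP.spectral_theorem
    rwa [Unitary.conjStarAlgAut_apply] at h
  have hDD : D * D = D := by
    have h : Wᴴ * (P * P) * W = Wᴴ * P * W := by rw [hPP]
    have e : Wᴴ * P * W = D := by
      rw [hspec, show Wᴴ * (W * D * Wᴴ) * W = (Wᴴ * W) * D * (Wᴴ * W) by
        simp only [Matrix.mul_assoc], hWW, Matrix.one_mul, Matrix.mul_one]
    have e' : Wᴴ * (P * P) * W = (Wᴴ * P * W) * (Wᴴ * P * W) := by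
      rw [show (Wᴴ * P * W) * (Wᴴ * P * W) = Wᴴ * P * (W * Wᴴ) * P * W by
        simp only [Matrix.mul_assoc], hWW', Matrix.mul_one]
      simp only [Matrix.mul_assoc]
    rw [e', e] at h
    exact h
  have hev : ∀ z, (hP.eigenvalues z : ℂ) = if hP.eigenvalues z = 1 then 1 else 0 := by
    intro z
    have h := congrFun (congrFun hDD z) z
    rw [hD, diagonal_mul_diagonal, diagonal_apply_eq, diagonal_apply_eq] at h
    have h2 : hP.eigenvalues z * hP.eigenvalues z = hP.eigenvalues z := by
      simp only [Function.comp_apply] at h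
      exact_mod_cast h
    split_ifs with h1
    · simp [h1]
    · have : hP.eigenvalues z * (hP.eigenvalues z - 1) = 0 := by linarith
      rcases mul_eq_zero.mp this with h0 | h0
      · simp [h0]
      · exact absurd (by linarith) h1
  let S := {z : X // hP.eigenvalues z = 1}
  let e : Fin (Fintype.card S) ≃ S := (Fintype.equivFin S).symm
  refine ⟨Fintype.card S, W.submatrix id (fun z => (e z : X)), ?_, ?_⟩
  · ext a b
    have h := congrFun (congrFun hWW (e a : X)) (e b : X)
    simp only [mul_apply, conjTranspose_apply, submatrix_apply, id, one_apply] at h ⊢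
    rw [h]
    simp [Subtype.coe_inj]
  · ext x y
    have hxy := congrFun (congrFun hspec x) y
    rw [hD] at hxy
    rw [hxy, mul_apply, mul_apply]
    simp only [mul_diagonal, conjTranspose_apply, submatrix_apply, id]
    rw [Equiv.sum_comp e (fun z : S => W x z * star (W y z))]
    simp only [Function.comp_apply, RCLike.ofReal_eq_complex_ofReal, hev, mul_ite, mul_one,
      mul_zero, ite_mul, zero_mul]
    rw [← Finset.sum_filter]
    exact (Finset.sum_subtype _ (by simp) (fun z => W x z * star (W y z))).symm

/-- A unitary, given by its blocks, without signalling from the input `cO` to the output `cI`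
factors into a unitary preparing `cI` followed by a unitary acting on `cO`. -/
lemma exists_factorization_of_no_signalling {X Y cI cO : Type*}
    [Fintype X] [Fintype Y] [Fintype cI] [Fintype cO]
    [DecidableEq X] [DecidableEq Y] [DecidableEq cI] [DecidableEq cO]
    (i₀ : cI) (j₀ : cO) (u : cI → cO → Matrix Y X ℂ)
    (hcol : ∑ i, (u i j₀)ᴴ * u i j₀ = 1)
    (hrow : ∀ i k, ∑ j, u i j * (u k j)ᴴ = if i = k then 1 else 0)
    (hns : ∀ i k j l j', (u i j)ᴴ * u k l = if j = l then (u i j')ᴴ * u k j' else 0) :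
    ∃ (nz : ℕ) (U₁ : Matrix (cI × Fin nz) X ℂ) (U₂ : Matrix Y (cO × Fin nz) ℂ),
      U₁ᴴ * U₁ = 1 ∧ U₁ * U₁ᴴ = 1 ∧ U₂ᴴ * U₂ = 1 ∧ U₂ * U₂ᴴ = 1 ∧
      ∀ i j y x, u i j y x = ∑ z, U₁ (i, z) x * U₂ y (j, z) := by
  set N : cI → cI → Matrix X X ℂ := fun i k => (u i j₀)ᴴ * u k j₀ with hN
  have hNs : ∀ i k, (N i k)ᴴ = N k i := fun i k => by simp [hN]
  have hT : ∀ i k j l, (u i j)ᴴ * u k l = if j = l then N i k else 0 :=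
    fun i k j l => hns i k j l j₀
  have huN : ∀ a j i k, u a j * N i k = if a = i then u k j else 0 := by
    intro a j i k
    calc u a j * N i k = ∑ l, u a l * ((u i l)ᴴ * u k j) := by
          rw [Finset.sum_eq_single j (fun l _ hl => by rw [hT, if_neg hl, Matrix.mul_zero])
            (by simp), hT, if_pos rfl]
      _ = (∑ l, u a l * (u i l)ᴴ) * u k j := by simp [Matrix.sum_mul, Matrix.mul_assoc]
      _ = _ := by rw [hrow]; split_ifs <;> simp
  have hNN : ∀ i k k' l, N i k * N k' l = if k = k' then N i l else 0 := by
    intro i k k' l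
    change (u i j₀)ᴴ * u k j₀ * N k' l = _
    rw [Matrix.mul_assoc, huN]
    split_ifs <;> simp [hN]
  obtain ⟨r, J, hJ, hJ'⟩ := exists_isometry_of_isHermitian_of_idempotent (N i₀ i₀) (hNs _ _)
    (by simp [hNN])
  have hJNJ : Jᴴ * N i₀ i₀ * J = 1 := by
    rw [← hJ', ← Matrix.mul_assoc, hJ, Matrix.one_mul, hJ]
  set A : cI → Matrix (Fin r) X ℂ := fun i => Jᴴ * N i₀ i with hA
  set B : cO → Matrix Y (Fin r) ℂ := fun j => u i₀ j * J with hB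
  have hAA : ∑ i, (A i)ᴴ * A i = 1 := by
    rw [← hcol]
    refine Finset.sum_congr rfl fun i _ => ?_
    calc (A i)ᴴ * A i = N i i₀ * (J * Jᴴ) * N i₀ i := by
          simp [hA, hNs, Matrix.mul_assoc]
      _ = _ := by rw [hJ', hNN, if_pos rfl, hNN, if_pos rfl]
  have hAA' : ∀ i k, A i * (A k)ᴴ = if i = k then 1 else 0 := by
    intro i k
    calc A i * (A k)ᴴ = Jᴴ * (N i₀ i * N k i₀) * J := by simp [hA, hNs, Matrix.mul_assoc]
      _ = _ := by rw [hNN]; split_ifs <;> simp [hJNJ]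
  have hBB : ∀ j l, (B j)ᴴ * B l = if j = l then 1 else 0 := by
    intro j l
    calc (B j)ᴴ * B l = Jᴴ * ((u i₀ j)ᴴ * u i₀ l) * J := by simp [hB, Matrix.mul_assoc]
      _ = _ := by rw [hT]; split_ifs <;> simp [hJNJ]
  have hBB' : ∑ j, B j * (B j)ᴴ = 1 := by
    have h := hrow i₀ i₀
    rw [if_pos rfl] at h
    rw [← h]
    refine Finset.sum_congr rfl fun j _ => ?_
    calc B j * (B j)ᴴ = u i₀ j * (J * Jᴴ) * (u i₀ j)ᴴ := by simp [hB, Matrix.mul_assoc]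
      _ = _ := by rw [hJ', huN, if_pos rfl]
  have hBA : ∀ i j, u i j = B j * A i := by
    intro i j
    calc u i j = u i₀ j * (J * Jᴴ) * N i₀ i := by
          rw [hJ', huN, if_pos rfl, huN, if_pos rfl]
      _ = _ := by simp [hA, hB, Matrix.mul_assoc]
  refine ⟨r, of fun q x => A q.1 q.2 x, of fun y q => B q.1 y q.2, ?_, ?_, ?_, ?_, ?_⟩
  · ext x x'
    simpa [mul_apply, Matrix.sum_apply, Fintype.sum_prod_type] using
      congrFun (congrFun hAA x) x'
  · ext ⟨i, z⟩ ⟨k, w⟩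
    have h := congrFun (congrFun (hAA' i k) z) w
    rw [mul_apply] at h ⊢
    refine h.trans ?_
    by_cases hik : i = k <;> simp [hik, one_apply]
  · ext ⟨i, z⟩ ⟨k, w⟩
    have h := congrFun (congrFun (hBB i k) z) w
    rw [mul_apply] at h ⊢
    refine h.trans ?_
    by_cases hik : i = k <;> simp [hik, one_apply]
  · ext y y'
    simpa [mul_apply, Matrix.sum_apply, Fintype.sum_prod_type] using
      congrFun (congrFun hBB' y) y'
  · intro i j y x
    rw [hBA, mul_apply]
    exact Finset.sum_congr rfl fun z _ => mul_comm _ _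

/-- The link product of a map with blocks `u i j` with a local operation on the systems
`cI`, `cO`. -/
def blockLink {X Y cI cO cI' cO' : Type*} [Fintype cI] [Fintype cO]
    (u : cI → cO → Matrix Y X ℂ) (K : Matrix (cO × cO') (cI × cI') ℂ) :
    Matrix (Y × cO') (X × cI') ℂ :=
  of fun p q => ∑ i, ∑ j, u i j p.1 q.1 * K (j, p.2) (i, q.2)

/-- The link product with the swap of `cI` and `cO` preceded by `K`. -/
def swapLink {X Y cI cO : Type*} [Fintype cI] [Fintype cO] (u : cI → cO → Matrix Y X ℂ) :
    Matrix (cI × cO) (cI × cO) ℂ →ₗ[ℂ] Matrix (Y × cI) (X × cO) ℂ where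
  toFun K := blockLink u (K.submatrix Prod.swap id)
  map_add' K K' := by
    ext p q
    simp [blockLink, mul_add, Finset.sum_add_distrib]
  map_smul' c K := by
    ext p q
    simp only [blockLink, of_apply, submatrix_apply, Matrix.smul_apply, smul_eq_mul,
      Finset.mul_sum, RingHom.id_apply]
    exact Finset.sum_congr rfl fun i _ => Finset.sum_congr rfl fun j _ => by ring

lemma swapLink_one_apply {X Y cI cO : Type*} [Fintype cI] [Fintype cO]
    [DecidableEq cI] [DecidableEq cO]
    (u : cI → cO → Matrix Y X ℂ) (y : Y) (i : cI) (x : X) (j : cO) :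
    swapLink u 1 (y, i) (x, j) = u i j y x := by
  simp [swapLink, blockLink, one_apply, Prod.ext_iff, ite_and]

lemma swapLink_single_apply {X Y cI cO : Type*} [Fintype cI] [Fintype cO]
    [DecidableEq cI] [DecidableEq cO]
    (u : cI → cO → Matrix Y X ℂ) (i k : cI) (j l : cO) (y : Y) (a : cI) (x : X) (b : cO) :
    swapLink u (Matrix.single (i, j) (k, l) 1) (y, a) (x, b) =
      if a = i ∧ b = l then u k j y x else 0 := by
  by_cases hai : i = a <;> by_cases hbl : l = b <;>
    simp [swapLink, blockLink, Matrix.single_apply, Prod.ext_iff, hai, hbl, eq_comm (a := a),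
      eq_comm (a := b), ite_and]

open scoped ComplexOrder in
/-- The first-order consequence of reversibility preservation around the swap. -/
lemma swapLink_one_conjTranspose_mul {X Y cI cO : Type*}
    [Fintype X] [Fintype Y] [Fintype cI] [Fintype cO]
    [DecidableEq X] [DecidableEq cI] [DecidableEq cO]
    (u : cI → cO → Matrix Y X ℂ)
    (hu : ∀ K : Matrix (cI × cO) (cI × cO) ℂ, Kᴴ * K = 1 →
      (swapLink u K)ᴴ * swapLink u K = 1)
    (K : Matrix (cI × cO) (cI × cO) ℂ) :
    (swapLink u 1)ᴴ * swapLink u K = (swapLink u Kᴴ)ᴴ * swapLink u 1 := by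
  set L := swapLink u with hL
  set D : Matrix (cI × cO) (cI × cO) ℂ → Prop := fun K => (L 1)ᴴ * L K = (L Kᴴ)ᴴ * L 1 with hD
  have hadd : ∀ {K K'}, D K → D K' → D (K + K') := by
    intro K K' h h'
    simp only [hD, conjTranspose_add, map_add, Matrix.mul_add, Matrix.add_mul] at h h' ⊢
    rw [h, h']
  have hsmul : ∀ (c : ℂ) {K}, D K → D (c • K) := by
    intro c K h
    simp only [hD, conjTranspose_smul, map_smul, Matrix.mul_smul, Matrix.smul_mul,
      star_star] at h ⊢
    rw [h]
  have hinv : ∀ H : Matrix (cI × cO) (cI × cO) ℂ, Hᴴ = H → H * H = 1 → D H := by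
    intro H h1 h2
    have hunit := hu ((3 / 5 : ℂ) • 1 + (4 / 5 * Complex.I : ℂ) • H) (by
      simp only [conjTranspose_add, conjTranspose_smul, conjTranspose_one, h1, Matrix.add_mul,
        Matrix.mul_add, Matrix.smul_mul, Matrix.mul_smul, h2, Matrix.one_mul, Matrix.mul_one]
      ext p q
      simp only [Matrix.add_apply, Matrix.smul_apply, smul_eq_mul, star_mul', star_div₀, star_ofNat,
        Complex.star_def, Complex.conj_I]
      linear_combination (16 / 25 * (1 : Matrix (cI × cO) (cI × cO) ℂ) p q) * (-Complex.I_sq))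
    have hone := hu 1 (by simp)
    have hH := hu H (by rw [h1, h2])
    simp only [map_add, map_smul, conjTranspose_add, conjTranspose_smul, Matrix.add_mul,
      Matrix.mul_add, Matrix.smul_mul, Matrix.mul_smul, hone, hH] at hunit
    simp only [hD, h1]
    ext p q
    have h := congrFun (congrFun hunit p) q
    simp only [Matrix.add_apply, Matrix.smul_apply, smul_eq_mul, star_mul', star_div₀, star_ofNat,
        Complex.star_def, Complex.conj_I] at h
    linear_combination (-25 / 12 * Complex.I) * h + (16 / 25 * (25 / 12) * (-Complex.I)
      * (1 : Matrix (X × cO) (X × cO) ℂ) p q + ((L 1)ᴴ * L H) p q - ((L H)ᴴ * L 1) p q)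
      * Complex.I_sq
  have hDone : D 1 := by simp [hD]
  have hproj : ∀ P : Matrix (cI × cO) (cI × cO) ℂ, Pᴴ = P → P * P = P → D P := by
    intro P h1 h2
    have h := hinv (1 - (2 : ℂ) • P) (by simp [h1]) (by
      simp only [sub_mul, mul_sub, Matrix.one_mul, Matrix.mul_one, Matrix.smul_mul,
        Matrix.mul_smul, h2]
      module)
    have e : P = (1 / 2 : ℂ) • 1 + (-1 / 2 : ℂ) • (1 - (2 : ℂ) • P) := by module
    rw [e]
    exact hadd (hsmul _ hDone) (hsmul _ h)
  have hvec : ∀ v : cI × cO → ℂ, D (vecMulVec v (star v)) := by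
    intro v
    by_cases hv : v = 0
    · simp [hD, hv]
    set s : ℂ := star v ⬝ᵥ v with hs
    have hs0 : s ≠ 0 := by rwa [hs, ne_eq, dotProduct_star_self_eq_zero]
    have hss : star s = s := (star_dotProduct v v).symm
    have h := hproj (s⁻¹ • vecMulVec v (star v))
      (by simp [conjTranspose_smul, conjTranspose_vecMulVec, hss])
      (by
        rw [Matrix.smul_mul, Matrix.mul_smul, vecMulVec_mul_vecMulVec, ← hs, smul_smul]
        ext p q
        simp [vecMulVec_apply]
        field_simp)
    have h' := hsmul s h
    rwa [smul_smul, mul_inv_cancel₀ hs0, one_smul] at h'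
  have hpol : ∀ v w : cI × cO → ℂ, D (vecMulVec v (star w)) := by
    intro v w
    have e : vecMulVec v (star w) = (1 / 4 : ℂ) • (vecMulVec (v + w) (star (v + w))
        + ((-1 : ℂ) • vecMulVec (v - w) (star (v - w))
        + (Complex.I • vecMulVec (v + Complex.I • w) (star (v + Complex.I • w))
        + (-Complex.I) • vecMulVec (v - Complex.I • w) (star (v - Complex.I • w))))) := by
      ext p q
      simp only [vecMulVec_apply, Matrix.smul_apply, Matrix.add_apply, Pi.add_apply, Pi.sub_apply,
        Pi.smul_apply, Pi.star_apply, star_add, star_sub, smul_eq_mul, star_mul', Complex.star_def,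
        Complex.conj_I]
      linear_combination (1 / 2 * v p * (starRingEnd ℂ) (w q)
        - 1 / 2 * w p * (starRingEnd ℂ) (v q)) * Complex.I_sq
    rw [e]
    exact hsmul _ (hadd (hvec _) (hadd (hsmul _ (hvec _))
      (hadd (hsmul _ (hvec _)) (hsmul _ (hvec _)))))
  change D K
  rw [matrix_eq_sum_single K]
  refine Finset.sum_induction _ D (fun _ _ => hadd) (by simp [hD]) fun p _ =>
    Finset.sum_induction _ D (fun _ _ => hadd) (by simp [hD]) fun q _ => ?_
  have h := hsmul (K p q) (hpol (Pi.single p 1) (Pi.single q 1))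
  rw [Pi.star_single, star_one, ← single_eq_single_vecMulVec_single, smul_single, smul_eq_mul,
    mul_one] at h
  exact h

/-- Reversibility preservation forbids signalling from `cO` to `cI`. -/
lemma no_signalling_of_swapLink_isometry {X Y cI cO : Type*}
    [Fintype X] [Fintype Y] [Fintype cI] [Fintype cO]
    [DecidableEq X] [DecidableEq cI] [DecidableEq cO]
    (u : cI → cO → Matrix Y X ℂ)
    (hu : ∀ K : Matrix (cI × cO) (cI × cO) ℂ, Kᴴ * K = 1 →
      (swapLink u K)ᴴ * swapLink u K = 1)
    (i k : cI) (j l j' : cO) :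
    (u i j)ᴴ * u k l = if j = l then (u i j')ᴴ * u k j' else 0 := by
  ext x x'
  have h := congrFun (congrFun
    (swapLink_one_conjTranspose_mul u hu (Matrix.single (i, l) (k, j') 1)) (x, j)) (x', j')
  rw [conjTranspose_single, star_one] at h
  simp only [mul_apply, conjTranspose_apply, Fintype.sum_prod_type, swapLink_one_apply,
    swapLink_single_apply, and_true] at h
  by_cases hjl : j = l <;> simpa [mul_apply, hjl, apply_ite, ite_and] using h

lemma submatrix_equiv_unitary {m n m' n' : Type*}
    [Fintype m] [Fintype n] [Fintype m'] [Fintype n']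
    [DecidableEq m] [DecidableEq n] [DecidableEq m'] [DecidableEq n']
    {M : Matrix m n ℂ} (h₁ : Mᴴ * M = 1) (h₂ : M * Mᴴ = 1) (e : m' ≃ m) (f : n' ≃ n) :
    (M.submatrix e f)ᴴ * M.submatrix e f = 1 ∧ M.submatrix e f * (M.submatrix e f)ᴴ = 1 := by
  rw [conjTranspose_submatrix, submatrix_mul_equiv, submatrix_mul_equiv, h₁, h₂,
    submatrix_one_equiv, submatrix_one_equiv]
  exact ⟨rfl, rfl⟩

/-- If linking with local unitaries with ancillas in `Type` gives unitaries, then so does linking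
with the swap of `cI` and `cO` preceded by a unitary. -/
lemma swapLink_unitary_of_blockLink_unitary {X Y cI cO : Type*}
    [Fintype X] [Fintype Y] [Fintype cI] [Fintype cO]
    [DecidableEq X] [DecidableEq Y] [DecidableEq cI] [DecidableEq cO]
    (u : cI → cO → Matrix Y X ℂ)
    (hu : ∀ (cI' cO' : Type) [Fintype cI'] [DecidableEq cI'] [Fintype cO'] [DecidableEq cO']
      (K : Matrix (cO × cO') (cI × cI') ℂ), Kᴴ * K = 1 → K * Kᴴ = 1 →
        (blockLink u K)ᴴ * blockLink u K = 1 ∧ blockLink u K * (blockLink u K)ᴴ = 1)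
    (K : Matrix (cI × cO) (cI × cO) ℂ) (hK : Kᴴ * K = 1) :
    (swapLink u K)ᴴ * swapLink u K = 1 ∧ swapLink u K * (swapLink u K)ᴴ = 1 := by
  have hK' : K * Kᴴ = 1 := mul_eq_one_comm.mp hK
  let eI := Fintype.equivFin cI
  let eO := Fintype.equivFin cO
  obtain ⟨h₁, h₂⟩ := submatrix_equiv_unitary hK hK'
    (((Equiv.refl cO).prodCongr eI.symm).trans (Equiv.prodComm cO cI))
    ((Equiv.refl cI).prodCongr eO.symm)
  obtain ⟨h₁, h₂⟩ := hu _ _ _ h₁ h₂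
  have h := submatrix_equiv_unitary h₁ h₂ ((Equiv.refl Y).prodCongr eI)
    ((Equiv.refl X).prodCongr eO)
  convert h using 3 <;> ext p q <;> simp [swapLink, blockLink]

/-- A unitary whose links with the swap preceded by unitaries are unitary factors into a unitary
preparing `cI` followed by a unitary acting on `cO`. -/
lemma exists_factorization_of_swapLink_unitary {X Y cI cO : Type*}
    [Fintype X] [Fintype Y] [Fintype cI] [Fintype cO]
    [DecidableEq X] [DecidableEq Y] [DecidableEq cI] [DecidableEq cO]
    (i₀ : cI) (j₀ : cO) (u : cI → cO → Matrix Y X ℂ)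
    (hu : ∀ K : Matrix (cI × cO) (cI × cO) ℂ, Kᴴ * K = 1 →
      (swapLink u K)ᴴ * swapLink u K = 1 ∧ swapLink u K * (swapLink u K)ᴴ = 1) :
    ∃ (nz : ℕ) (U₁ : Matrix (cI × Fin nz) X ℂ) (U₂ : Matrix Y (cO × Fin nz) ℂ),
      U₁ᴴ * U₁ = 1 ∧ U₁ * U₁ᴴ = 1 ∧ U₂ᴴ * U₂ = 1 ∧ U₂ * U₂ᴴ = 1 ∧
      ∀ i j y x, u i j y x = ∑ z, U₁ (i, z) x * U₂ y (j, z) := by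
  obtain ⟨h₁, h₂⟩ := hu 1 (by simp)
  refine exists_factorization_of_no_signalling i₀ j₀ u ?_ ?_
    (no_signalling_of_swapLink_isometry u fun K hK => (hu K hK).1)
  · ext x x'
    have h := congrFun (congrFun h₁ (x, j₀)) (x', j₀)
    simp only [mul_apply, conjTranspose_apply, Fintype.sum_prod_type_right,
      swapLink_one_apply, one_apply, Prod.mk.injEq, and_true] at h
    simpa only [Matrix.sum_apply, mul_apply, conjTranspose_apply, one_apply] using h
  · intro i k
    ext y y'
    have h := congrFun (congrFun h₂ (y, i)) (y', k)
    simp only [mul_apply, conjTranspose_apply, Fintype.sum_prod_type_right,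
      swapLink_one_apply, one_apply, Prod.mk.injEq] at h
    simp only [Matrix.sum_apply, mul_apply, conjTranspose_apply]
    rw [h]
    by_cases hik : i = k <;> simp [hik, one_apply]

/-- Linking with the swap for the first two parties turns reversibility preservation into
a property of the third party alone. -/
lemma blockLink_unitary_of_preserves_reversibility
    {pO aO bO cO fI aI bI cI : Type*}
    [Fintype pO] [Fintype aO] [Fintype bO] [Fintype cO] [Fintype fI]
    [Fintype aI] [Fintype bI] [Fintype cI]
    [DecidableEq pO] [DecidableEq aO] [DecidableEq bO] [DecidableEq cO]
    [DecidableEq fI] [DecidableEq aI] [DecidableEq bI] [DecidableEq cI]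
    (U : Matrix (fI × aI × bI × cI) (pO × aO × bO × cO) ℂ)
    (hRev : ∀ (aI' aO' bI' bO' cI' cO' : Type)
      [Fintype aI'] [DecidableEq aI'] [Fintype aO'] [DecidableEq aO']
      [Fintype bI'] [DecidableEq bI'] [Fintype bO'] [DecidableEq bO']
      [Fintype cI'] [DecidableEq cI'] [Fintype cO'] [DecidableEq cO'],
      ∀ (UA : Matrix (aO × aO') (aI × aI') ℂ) (UB : Matrix (bO × bO') (bI × bI') ℂ)
        (UC : Matrix (cO × cO') (cI × cI') ℂ),
        UAᴴ * UA = 1 → UA * UAᴴ = 1 → UBᴴ * UB = 1 → UB * UBᴴ = 1 →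
        UCᴴ * UC = 1 → UC * UCᴴ = 1 →
        ∃ V : Matrix (fI × aO' × bO' × cO') (pO × aI' × bI' × cI') ℂ,
          Vᴴ * V = 1 ∧ V * Vᴴ = 1 ∧
          ∀ (p : pO) (ai' : aI') (bi' : bI') (ci' : cI')
            (f : fI) (ao' : aO') (bo' : bO') (co' : cO'),
            V (f, ao', bo', co') (p, ai', bi', ci') =
              ∑ ai : aI, ∑ ao : aO, ∑ bi : bI, ∑ bo : bO, ∑ ci : cI, ∑ co : cO,
                U (f, ai, bi, ci) (p, ao, bo, co) * UA (ao, ao') (ai, ai')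
                  * UB (bo, bo') (bi, bi') * UC (co, co') (ci, ci'))
    (cI' cO' : Type) [Fintype cI'] [DecidableEq cI'] [Fintype cO'] [DecidableEq cO']
    (K : Matrix (cO × cO') (cI × cI') ℂ) (hK : Kᴴ * K = 1) (hK' : K * Kᴴ = 1) :
    let u : cI → cO → Matrix (aI × bI × fI) (pO × aO × bO) ℂ := fun i j =>
      of fun y x => U (y.2.2, y.1, y.2.1, i) (x.1, x.2.1, x.2.2, j)
    (blockLink u K)ᴴ * blockLink u K = 1 ∧ blockLink u K * (blockLink u K)ᴴ = 1 := by
  intro u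
  let eaI := Fintype.equivFin aI
  let eaO := Fintype.equivFin aO
  let ebI := Fintype.equivFin bI
  let ebO := Fintype.equivFin bO
  obtain ⟨hA, hA'⟩ := submatrix_equiv_unitary (M := (1 : Matrix (aO × aI) (aO × aI) ℂ))
    (by simp) (by simp) ((Equiv.refl aO).prodCongr eaI.symm)
    (((Equiv.refl aI).prodCongr eaO.symm).trans (Equiv.prodComm aI aO))
  obtain ⟨hB, hB'⟩ := submatrix_equiv_unitary (M := (1 : Matrix (bO × bI) (bO × bI) ℂ))
    (by simp) (by simp) ((Equiv.refl bO).prodCongr ebI.symm)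
    (((Equiv.refl bI).prodCongr ebO.symm).trans (Equiv.prodComm bI bO))
  obtain ⟨V, hV, hV', hVU⟩ := hRev _ _ _ _ cI' cO' _ _ K hA hA' hB hB' hK hK'
  let e : (aI × bI × fI) × cO' ≃
      fI × Fin (Fintype.card aI) × Fin (Fintype.card bI) × cO' :=
    { toFun := fun q => (q.1.2.2, eaI q.1.1, ebI q.1.2.1, q.2)
      invFun := fun q => ((eaI.symm q.2.1, ebI.symm q.2.2.1, q.1), q.2.2.2)
      left_inv := fun q => by simp
      right_inv := fun q => by simp }
  let f : (pO × aO × bO) × cI' ≃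
      pO × Fin (Fintype.card aO) × Fin (Fintype.card bO) × cI' :=
    { toFun := fun q => (q.1.1, eaO q.1.2.1, ebO q.1.2.2, q.2)
      invFun := fun q => ((q.1, eaO.symm q.2.1, ebO.symm q.2.2.1), q.2.2.2)
      left_inv := fun q => by simp
      right_inv := fun q => by simp }
  have hVe : blockLink u K = V.submatrix e f := by
    ext ⟨⟨ai, bi, fi⟩, co'⟩ ⟨⟨p, ao, bo⟩, ci'⟩
    simp [e, f, hVU, blockLink, u, one_apply, ite_and, mul_ite, ite_mul,
      Finset.sum_ite_irrel]
  rw [hVe]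
  exact submatrix_equiv_unitary hV hV' e f

/-- let
`U : H^{P_O} ⊗ H^{A_O} ⊗ H^{B_O} ⊗ H^{C_O} → H^{F_I} ⊗ H^{A_I} ⊗ H^{B_I} ⊗ H^{C_I}` be a
unitary extension of a tripartite process, i.e. a unitary (with `dim H^{X_I} = dim H^{X_O}`
for `X = A, B, C`) that preserves reversibility: for all finite-dimensional ancillas and
all local unitaries `U_A`, `U_B`, `U_C`, the link `|U⟩⟩ * |U_A⟩⟩ * |U_B⟩⟩ * |U_C⟩⟩`
(contracting `A_I, A_O, B_I, B_O, C_I, C_O`) is the pure Choi vector of a unitary from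
`H^{P_O} ⊗ H^{A_I'} ⊗ H^{B_I'} ⊗ H^{C_I'}` to `H^{F_I} ⊗ H^{A_O'} ⊗ H^{B_O'} ⊗ H^{C_O'}`.
Then there exist isomorphic finite-dimensional spaces `H^Z ≅ H^{Z̄}` (modelled by a common
index type `Fin nz`) and unitaries `U₁ : H^{P_O} ⊗ H^{A_O} ⊗ H^{B_O} → H^{C_I} ⊗ H^Z` and
`U₂ : H^{C_O} ⊗ H^{Z̄} → H^{A_I} ⊗ H^{B_I} ⊗ H^{F_I}` such that
`|U⟩⟩ = |U₁⟩⟩ * |𝟙⟩⟩^{ZZ̄} * |U₂⟩⟩`; that is, `U` maps a subsystem of `P_O A_O B_O`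
isomorphically onto `C_I` and maps `C_O` isomorphically onto a subsystem of `A_I B_I F_I`.
Everything is expressed entrywise in fixed computational bases. -/
theorem unitary_extension_tripartite_decomposition
    {pO aO bO cO fI aI bI cI : Type*}
    [Fintype pO] [Fintype aO] [Fintype bO] [Fintype cO] [Fintype fI]
    [Fintype aI] [Fintype bI] [Fintype cI]
    [DecidableEq pO] [DecidableEq aO] [DecidableEq bO] [DecidableEq cO]
    [DecidableEq fI] [DecidableEq aI] [DecidableEq bI] [DecidableEq cI]
    (hcardA : Fintype.card aI = Fintype.card aO)
    (hcardB : Fintype.card bI = Fintype.card bO)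
    (hcardC : Fintype.card cI = Fintype.card cO)
    (U : Matrix (fI × aI × bI × cI) (pO × aO × bO × cO) ℂ)
    (hU₁ : Uᴴ * U = 1) (hU₂ : U * Uᴴ = 1)
    (hRev : ∀ (aI' aO' bI' bO' cI' cO' : Type)
      [Fintype aI'] [DecidableEq aI'] [Fintype aO'] [DecidableEq aO']
      [Fintype bI'] [DecidableEq bI'] [Fintype bO'] [DecidableEq bO']
      [Fintype cI'] [DecidableEq cI'] [Fintype cO'] [DecidableEq cO'],
      ∀ (UA : Matrix (aO × aO') (aI × aI') ℂ) (UB : Matrix (bO × bO') (bI × bI') ℂ)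
        (UC : Matrix (cO × cO') (cI × cI') ℂ),
        UAᴴ * UA = 1 → UA * UAᴴ = 1 → UBᴴ * UB = 1 → UB * UBᴴ = 1 →
        UCᴴ * UC = 1 → UC * UCᴴ = 1 →
        ∃ V : Matrix (fI × aO' × bO' × cO') (pO × aI' × bI' × cI') ℂ,
          Vᴴ * V = 1 ∧ V * Vᴴ = 1 ∧
          ∀ (p : pO) (ai' : aI') (bi' : bI') (ci' : cI')
            (f : fI) (ao' : aO') (bo' : bO') (co' : cO'),
            V (f, ao', bo', co') (p, ai', bi', ci') =
              ∑ ai : aI, ∑ ao : aO, ∑ bi : bI, ∑ bo : bO, ∑ ci : cI, ∑ co : cO,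
                U (f, ai, bi, ci) (p, ao, bo, co) * UA (ao, ao') (ai, ai')
                  * UB (bo, bo') (bi, bi') * UC (co, co') (ci, ci')) :
    ∃ (nz : ℕ) (U₁ : Matrix (cI × Fin nz) (pO × aO × bO) ℂ)
      (U₂ : Matrix (aI × bI × fI) (cO × Fin nz) ℂ),
      U₁ᴴ * U₁ = 1 ∧ U₁ * U₁ᴴ = 1 ∧ U₂ᴴ * U₂ = 1 ∧ U₂ * U₂ᴴ = 1 ∧
      ∀ (f : fI) (ai : aI) (bi : bI) (ci : cI) (p : pO) (ao : aO) (bo : bO) (co : cO),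
        U (f, ai, bi, ci) (p, ao, bo, co) =
          ∑ z : Fin nz, U₁ (ci, z) (p, ao, bo) * U₂ (ai, bi, f) (co, z) := by
  let u : cI → cO → Matrix (aI × bI × fI) (pO × aO × bO) ℂ := fun i j =>
    of fun y x => U (y.2.2, y.1, y.2.1, i) (x.1, x.2.1, x.2.2, j)
  have hlink := blockLink_unitary_of_preserves_reversibility U hRev
  have hswap := swapLink_unitary_of_blockLink_unitary u hlink
  rcases isEmpty_or_nonempty cI with hcI | ⟨⟨i₀⟩⟩
  · obtain ⟨h₁, h₂⟩ := hlink Unit Unit 0 (Subsingleton.elim _ _)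
      (have : IsEmpty cO := Fintype.card_eq_zero_iff.mp (by rw [← hcardC]; simp)
       Subsingleton.elim _ _)
    have hz : blockLink u (0 : Matrix (cO × Unit) (cI × Unit) ℂ) = 0 := by
      ext p q
      simp [blockLink]
    rw [show blockLink _ _ = _ from hz] at h₁ h₂
    have hX : IsEmpty (pO × aO × bO) :=
      ⟨fun x => by simpa using congrFun (congrFun h₁ (x, ())) (x, ())⟩
    have hY : IsEmpty (aI × bI × fI) :=
      ⟨fun y => by simpa using congrFun (congrFun h₂ (y, ())) (y, ())⟩
    exact ⟨0, 0, 0, Subsingleton.elim _ _, Subsingleton.elim _ _, Subsingleton.elim _ _,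
      Subsingleton.elim _ _, fun _ _ _ i => hcI.elim i⟩
  · have hcO : Nonempty cO :=
      Fintype.card_pos_iff.mp (hcardC ▸ Fintype.card_pos_iff.mpr ⟨i₀⟩)
    obtain ⟨nz, U₁, U₂, hU₁, hU₁', hU₂, hU₂', h⟩ :=
      exists_factorization_of_swapLink_unitary i₀ hcO.some u hswap
    exact ⟨nz, U₁, U₂, hU₁, hU₁', hU₂, hU₂', fun f ai bi ci p ao bo co =>
      h ci co (ai, bi, f) (p, ao, bo)⟩
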